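/- For every natural number N ≥ 2, the derivative L′_{N−1} of the Legendre polynomial of degree N − 1 has exactly N − 2 distinct real roots, all lying in the open interval (−1, 1). (Together with the endpoints −1 and 1, these roots form the N Legendre–Gauss–Lobatto collocation nodes.) -/

import Mathlib

/-- The Legendre polynomial of degree `k`, defined by Rodrigues' formula
`L_k(x) = (1/(2^k k!)) dᵏ/dxᵏ [(x² − 1)ᵏ]`. -/
noncomputable def legendre (k : ℕ) : Polynomial ℝ :=
  ((1 : ℝ) / (2 ^ k * k.factorial)) •
    ((fun p : Polynomial ℝ => Polynomial.derivative p)^[k] ((Polynomial.X ^ 2 - 1) ^ k))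

open Polynomial in
/-- Rolle's theorem for polynomials, localized: the roots of `p` in `[a, b]` are interlaced by
roots of `p.derivative` in `(a, b)`. -/
theorem card_le_card_derivative_roots_Ioo_add_one {p : ℝ[X]} (hp : derivative p ≠ 0) {a b : ℝ}
    {T : Finset ℝ} (hT : ∀ x ∈ T, x ∈ Set.Icc a b ∧ p.eval x = 0) :
    T.card ≤ ((derivative p).roots.toFinset.filter (· ∈ Set.Ioo a b)).card + 1 := by
  refine Finset.card_le_of_interleaved fun x hx y hy hxy _ => ?_
  obtain ⟨z, hz, hpz⟩ := exists_deriv_eq_zero hxy p.continuousOn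
    ((hT x hx).2.trans (hT y hy).2.symm)
  refine ⟨z, ?_, hz⟩
  rw [Polynomial.deriv] at hpz
  simp only [Finset.mem_filter, Multiset.mem_toFinset, mem_roots hp, IsRoot.def]
  exact ⟨hpz, (hT x hx).1.1.trans_lt hz.1, hz.2.trans_le (hT y hy).1.2⟩

open Polynomial in
theorem natDegree_X_sq_sub_one_pow (m : ℕ) : ((X ^ 2 - 1 : ℝ[X]) ^ m).natDegree = m * 2 := by
  rw [natDegree_pow, ← C_1, natDegree_X_pow_sub_C]

open Polynomial in
theorem iterate_derivative_X_sq_sub_one_pow_ne_zero {m k : ℕ} (hk : k ≤ m * 2) :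
    derivative^[k] ((X ^ 2 - 1 : ℝ[X]) ^ m) ≠ 0 := by
  have hne : (X ^ 2 - 1 : ℝ[X]) ^ m ≠ 0 :=
    pow_ne_zero _ (by rw [← C_1]; exact X_pow_sub_C_ne_zero two_pos 1)
  intro h
  have hc := congrArg (coeff · (m * 2 - k)) h
  simp only [coeff_iterate_derivative, Nat.sub_add_cancel hk, coeff_zero, smul_eq_zero] at hc
  rcases hc with hc | hc
  · exact absurd (Nat.descFactorial_eq_zero_iff_lt.1 hc) (not_lt.2 hk)
  · rw [← natDegree_X_sq_sub_one_pow m, coeff_natDegree, leadingCoeff_eq_zero] at hc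
    exact hne hc

open Polynomial in
theorem eval_iterate_derivative_X_sq_sub_one_pow {m k : ℕ} (hk : k < m) {x : ℝ}
    (hx : x ^ 2 = 1) : (derivative^[k] ((X ^ 2 - 1 : ℝ[X]) ^ m)).eval x = 0 := by
  refine eval_eq_zero_of_dvd_of_eval_eq_zero
    (pow_sub_dvd_iterate_derivative_pow (X ^ 2 - 1 : ℝ[X]) m k) ?_
  simp [hx, (Nat.sub_pos_of_lt hk).ne']

open Polynomial in
theorem le_card_roots_iterate_derivative_X_sq_sub_one_pow {m k : ℕ} (hk : k ≤ m) :
    k ≤ ((derivative^[k] ((X ^ 2 - 1 : ℝ[X]) ^ m)).roots.toFinset.filter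
      (· ∈ Set.Ioo (-1 : ℝ) 1)).card := by
  induction k with
  | zero => exact Nat.zero_le _
  | succ k ih =>
    set q := derivative^[k] ((X ^ 2 - 1 : ℝ[X]) ^ m) with hq
    set T := q.roots.toFinset.filter (· ∈ Set.Ioo (-1 : ℝ) 1) with hT
    have hd : derivative q ≠ 0 := by
      rw [hq, ← Function.iterate_succ_apply' (f := derivative)]
      exact iterate_derivative_X_sq_sub_one_pow_ne_zero (by omega)
    have h1 : (1 : ℝ) ∉ T := by simp [hT]
    have h2 : (-1 : ℝ) ∉ insert 1 T := by
      rw [Finset.mem_insert, not_or]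
      exact ⟨by norm_num, by simp [hT]⟩
    have hroots : ∀ x ∈ insert (-1 : ℝ) (insert 1 T), x ∈ Set.Icc (-1 : ℝ) 1 ∧ q.eval x = 0 := by
      simp only [Finset.forall_mem_insert]
      refine ⟨⟨by norm_num, eval_iterate_derivative_X_sq_sub_one_pow hk (by norm_num)⟩,
        ⟨by norm_num, eval_iterate_derivative_X_sq_sub_one_pow hk (by norm_num)⟩, fun x hx => ?_⟩
      rw [hT, Finset.mem_filter, Multiset.mem_toFinset] at hx
      exact ⟨Set.Ioo_subset_Icc_self hx.2, isRoot_of_mem_roots hx.1⟩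
    have h := card_le_card_derivative_roots_Ioo_add_one hd hroots
    rw [Finset.card_insert_of_notMem h2, Finset.card_insert_of_notMem h1] at h
    rw [Function.iterate_succ_apply', ← hq]
    have := ih (by omega)
    omega

/-- For `N ≥ 2`, the derivative `L′_{N−1}` has exactly `N − 2` distinct
real roots, all lying in the open interval `(−1, 1)`. -/
theorem legendre_derivative_roots (N : ℕ) (hN : 2 ≤ N) :
    ∃ S : Finset ℝ, S.card = N - 2 ∧ (↑S ⊆ Set.Ioo (-1 : ℝ) 1) ∧
      ∀ x : ℝ, (Polynomial.derivative (legendre (N - 1))).eval x = 0 ↔ x ∈ S := by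
  obtain ⟨m, rfl⟩ : ∃ m, N = m + 2 := ⟨N - 2, by omega⟩
  set p : Polynomial ℝ := (Polynomial.X ^ 2 - 1) ^ (m + 1) with hp
  set q := Polynomial.derivative^[m + 1] p with hq
  have hdq : Polynomial.derivative q = Polynomial.derivative^[m + 2] p :=
    (Function.iterate_succ_apply' _ _ _).symm
  have hne : Polynomial.derivative q ≠ 0 :=
    hdq ▸ iterate_derivative_X_sq_sub_one_pow_ne_zero (by omega)
  have heval (x : ℝ) : (Polynomial.derivative (legendre (m + 2 - 1))).eval x = 0 ↔
      x ∈ (Polynomial.derivative q).roots.toFinset := by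
    have hL : legendre (m + 2 - 1) = ((1 : ℝ) / (2 ^ (m + 1) * (m + 1).factorial)) • q := rfl
    have hc : (1 : ℝ) / (2 ^ (m + 1) * (m + 1).factorial) ≠ 0 := by positivity
    rw [hL, Polynomial.derivative_smul, Polynomial.eval_smul, smul_eq_zero_iff_right hc,
      Multiset.mem_toFinset, Polynomial.mem_roots hne, Polynomial.IsRoot.def]
  have hdeg : (Polynomial.derivative q).natDegree ≤ m := by
    rw [hdq]
    refine (Polynomial.natDegree_iterate_derivative p (m + 2)).trans ?_
    rw [hp, natDegree_X_sq_sub_one_pow]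
    omega
  have hupper : (Polynomial.derivative q).roots.toFinset.card ≤ m :=
    (Multiset.toFinset_card_le _).trans ((Polynomial.card_roots' _).trans hdeg)
  have hlower : m + 1 ≤ ((Polynomial.derivative q).roots.toFinset.filter
      (· ∈ Set.Ioo (-1 : ℝ) 1)).card + 1 := by
    refine (le_card_roots_iterate_derivative_X_sq_sub_one_pow le_rfl).trans
      (card_le_card_derivative_roots_Ioo_add_one hne fun x hx => ?_)
    rw [Finset.mem_filter, Multiset.mem_toFinset] at hx
    exact ⟨Set.Ioo_subset_Icc_self hx.2, Polynomial.isRoot_of_mem_roots hx.1⟩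
  have hfilter := Finset.eq_of_subset_of_card_le
    (Finset.filter_subset (· ∈ Set.Ioo (-1 : ℝ) 1) (Polynomial.derivative q).roots.toFinset)
    (by omega)
  refine ⟨(Polynomial.derivative q).roots.toFinset, ?_, fun x hx => ?_, heval⟩
  · rw [hfilter] at hlower
    omega
  · rw [← hfilter] at hx
    exact (Finset.mem_filter.1 (Finset.mem_coe.1 hx)).2
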